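/- arXiv:1409.8390 — 8 statements merged into one kernel-verified Lean document; each statement's English description precedes it below -/
import Mathlib

section
/- Let G be a finite group and S a nonempty subset of G such that the subgroup ⟨S⟩ generated by S is nontrivial, and set σ = log |⟨S⟩|. Then there exists a subset A of G with |A| ≤ σ and ⟨A⟩ = ⟨S⟩ such that some SLP over S of reduced length at most σ² computes A, and for every g ∈ ⟨S⟩ some SLP over A of reduced length at most 2σ − 1 computes g. -/
/-- `log₂ m` is the least natural number `r` with `2 ^ r ≥ m`. -/
noncomputable def log₂ (m : ℕ) : ℕ := sInf {r : ℕ | m ≤ 2 ^ r}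

/-- A straight line program (SLP) over a subset `S` of a group `G` is a finite
sequence `y 0, …, y (n-1)` of elements of `G` in which each `y i` either lies
in `S`, or is the inverse of an earlier element, or the product of two earlier
elements. -/
def IsSLP {G : Type*} [Group G] (S : Set G) {n : ℕ} (y : Fin n → G) : Prop :=
  ∀ i : Fin n, y i ∈ S ∨ (∃ j, j < i ∧ y i = (y j)⁻¹) ∨
    ∃ j k, j < i ∧ k < i ∧ y i = y j * y k

/-- The reduced length of an SLP is the number of indices `i` with `y i ∉ S`. -/
noncomputable def reducedLength {G : Type*} (S : Set G) {n : ℕ} (y : Fin n → G) : ℕ :=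
  Nat.card {i : Fin n // y i ∉ S}

/-- Some SLP over `S` of reduced length at most `c` computes the set `X`. -/
def HasSLP {G : Type*} [Group G] (S : Set G) (c : ℕ) (X : Set G) : Prop :=
  ∃ (n : ℕ) (y : Fin n → G), IsSLP S y ∧ reducedLength S y ≤ c ∧ X ⊆ Set.range y

open Classical in
theorem reducedLength_snoc {G : Type*} (S : Set G) {n : ℕ} (y : Fin n → G) (g : G) :
    reducedLength S (Fin.snoc y g : Fin (n + 1) → G) =
      reducedLength S y + if g ∈ S then 0 else 1 := by
  simp only [reducedLength, Nat.card_eq_fintype_card, Fintype.card_subtype, Finset.card_filter,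
    Fin.sum_univ_castSucc, Fin.snoc_castSucc, Fin.snoc_last]
  split_ifs <;> simp_all

theorem reducedLength_snoc_le {G : Type*} (S : Set G) {n : ℕ} (y : Fin n → G) (g : G) :
    reducedLength S (Fin.snoc y g : Fin (n + 1) → G) ≤ reducedLength S y + 1 := by
  rw [reducedLength_snoc]
  split_ifs <;> omega

theorem IsSLP.snoc {G : Type*} [Group G] {S : Set G} {n : ℕ} {y : Fin n → G} (hy : IsSLP S y)
    {g : G} (hg : g ∈ S ∨ (∃ j, g = (y j)⁻¹) ∨ ∃ j k, g = y j * y k) :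
    IsSLP S (Fin.snoc y g : Fin (n + 1) → G) := by
  intro i
  induction i using Fin.lastCases with
  | last =>
    rcases hg with h | ⟨j, h⟩ | ⟨j, k, h⟩
    · exact Or.inl (by simpa using h)
    · exact Or.inr (Or.inl ⟨j.castSucc, Fin.castSucc_lt_last j, by simpa using h⟩)
    · exact Or.inr (Or.inr ⟨j.castSucc, k.castSucc, Fin.castSucc_lt_last j,
        Fin.castSucc_lt_last k, by simpa using h⟩)
  | cast i =>
    rcases hy i with h | ⟨j, hj, h⟩ | ⟨j, k, hj, hk, h⟩
    · exact Or.inl (by simpa using h)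
    · exact Or.inr (Or.inl ⟨j.castSucc, by simpa using hj, by simpa using h⟩)
    · exact Or.inr (Or.inr ⟨j.castSucc, k.castSucc, by simpa using hj, by simpa using hk,
        by simpa using h⟩)

theorem insert_subset_range_snoc {G : Type*} {n : ℕ} {y : Fin n → G} {X : Set G} (g : G)
    (hX : X ⊆ Set.range y) : insert g X ⊆ Set.range (Fin.snoc y g : Fin (n + 1) → G) := by
  rintro x (rfl | hx)
  · exact ⟨Fin.last n, by simp⟩
  · obtain ⟨i, rfl⟩ := hX hx
    exact ⟨i.castSucc, by simp⟩

namespace HasSLP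

variable {G : Type*} [Group G] {S X Y : Set G} {c d : ℕ}

theorem empty (S : Set G) : HasSLP S 0 ∅ :=
  ⟨0, Fin.elim0, fun i => i.elim0, by simp [reducedLength], by simp⟩

theorem mono (h : HasSLP S c X) (hcd : c ≤ d) (hYX : Y ⊆ X) : HasSLP S d Y := by
  obtain ⟨n, y, hy, hc, hX⟩ := h
  exact ⟨n, y, hy, hc.trans hcd, hYX.trans hX⟩

theorem insert_mem (h : HasSLP S c X) {s : G} (hs : s ∈ S) : HasSLP S c (insert s X) := by
  obtain ⟨n, y, hy, hc, hX⟩ := h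
  refine ⟨n + 1, Fin.snoc y s, hy.snoc (Or.inl hs), ?_, insert_subset_range_snoc s hX⟩
  simpa [reducedLength_snoc, hs] using hc

theorem insert_inv (h : HasSLP S c X) {x : G} (hx : x ∈ X) :
    HasSLP S (c + 1) (insert x⁻¹ X) := by
  obtain ⟨n, y, hy, hc, hX⟩ := h
  obtain ⟨i, rfl⟩ := hX hx
  refine ⟨n + 1, Fin.snoc y (y i)⁻¹, hy.snoc (Or.inr (Or.inl ⟨i, rfl⟩)), ?_,
    insert_subset_range_snoc _ hX⟩
  exact (reducedLength_snoc_le S y _).trans (by omega)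

theorem insert_mul (h : HasSLP S c X) {x z : G} (hx : x ∈ X) (hz : z ∈ X) :
    HasSLP S (c + 1) (insert (x * z) X) := by
  obtain ⟨n, y, hy, hc, hX⟩ := h
  obtain ⟨i, rfl⟩ := hX hx
  obtain ⟨j, rfl⟩ := hX hz
  refine ⟨n + 1, Fin.snoc y (y i * y j), hy.snoc (Or.inr (Or.inr ⟨i, j, rfl⟩)), ?_,
    insert_subset_range_snoc _ hX⟩
  exact (reducedLength_snoc_le S y _).trans (by omega)

theorem insert_prod (h : HasSLP S c X) (a : G) (l : List G) (hl : ∀ x ∈ a :: l, x ∈ X) :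
    HasSLP S (c + l.length) (insert (a :: l).prod X) := by
  induction l generalizing a with
  | nil => exact h.mono (by simp) (by simpa [Set.insert_subset_iff] using hl)
  | cons b l ih =>
    have hb := ih b fun x hx => hl x (List.mem_cons_of_mem _ hx)
    have ha : a ∈ insert (b :: l).prod X := Set.mem_insert_of_mem _ (hl a List.mem_cons_self)
    refine (hb.insert_mul ha (Set.mem_insert _ _)).mono (by simp [add_assoc]) ?_
    rw [List.prod_cons (a := a)]
    exact Set.insert_subset_insert (Set.subset_insert _ _)

theorem insert_prod_mul_prod_inv (h : HasSLP S c X) (P Q : List G) (hP : ∀ x ∈ P, x ∈ X)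
    (hQ : ∀ x ∈ Q, x ∈ X) (hne : P.prod * Q.prod⁻¹ ≠ 1) :
    HasSLP S (c + (P.length + Q.length)) (insert (P.prod * Q.prod⁻¹) X) := by
  rcases P with _ | ⟨a, P⟩ <;> rcases Q with _ | ⟨b, Q⟩
  · simp at hne
  · have h₁ := (h.insert_prod b Q hQ).insert_inv (Set.mem_insert _ _)
    refine h₁.mono (by simp [add_assoc]) ?_
    rw [List.prod_nil, one_mul]
    exact Set.insert_subset_insert (Set.subset_insert _ _)
  · refine (h.insert_prod a P hP).mono (by simp) ?_
    simp
  · have h₁ := (h.insert_prod b Q hQ).insert_inv (Set.mem_insert _ _)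
    have h₂ := h₁.insert_prod a P fun x hx =>
      Set.mem_insert_of_mem _ (Set.mem_insert_of_mem _ (hP x hx))
    have h₃ := h₂.insert_mul (Set.mem_insert _ _)
      (Set.mem_insert_of_mem _ (Set.mem_insert _ _))
    refine h₃.mono (by simp; omega) (Set.insert_subset_insert ?_)
    exact (Set.subset_insert _ _).trans
      ((Set.subset_insert _ _).trans (Set.subset_insert _ _))

theorem of_list (L : List G) (hL : ∀ x ∈ L, x ∈ S) : HasSLP S 0 {x | x ∈ L} := by
  induction L with
  | nil => exact (empty S).mono le_rfl (by simp)
  | cons a L ih =>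
    have h := (ih fun x hx => hL x (List.mem_cons_of_mem _ hx)).insert_mem
      (hL a List.mem_cons_self)
    exact h.mono le_rfl fun x hx => by simpa using hx

end HasSLP

/-- The list `L` of elements of `⟨S⟩` is cheap to compute from `S` and its subproducts are
pairwise distinct. -/
structure IsCubeBasis {G : Type*} [Group G] (S : Set G) (L : List G) : Prop where
  mem_closure : ∀ x ∈ L, x ∈ Subgroup.closure S
  hasSLP : HasSLP S (L.length ^ 2) {x | x ∈ L}
  nodup : (L.sublists'.map List.prod).Nodup

namespace IsCubeBasis

variable {G : Type*} [Group G] {S : Set G} {L : List G}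

theorem nil (S : Set G) : IsCubeBasis S [] :=
  ⟨by simp, (HasSLP.empty S).mono le_rfl (by simp), by simp⟩

theorem cons (h : IsCubeBasis S L) {P Q : List G} (hP : P.Sublist L) (hQ : Q.Sublist L) {s : G}
    (hs : s ∈ S) (hz : ∀ P' Q' : List G, P'.Sublist L → Q'.Sublist L →
      s * (P.prod * Q.prod⁻¹) ≠ P'.prod * Q'.prod⁻¹) :
    IsCubeBasis S (s * (P.prod * Q.prod⁻¹) :: L) where
  mem_closure := by
    have hprod : ∀ M : List G, M.Sublist L → M.prod ∈ Subgroup.closure S := fun M hM =>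
      Subgroup.list_prod_mem _ fun x hx => h.mem_closure x (hM.subset hx)
    have hmem := mul_mem (Subgroup.subset_closure hs)
      (mul_mem (hprod P hP) (inv_mem (hprod Q hQ)))
    simpa [hmem] using h.mem_closure
  hasSLP := by
    have hlen : L.length ^ 2 + (P.length + Q.length) + 1 ≤ (L.length + 1) ^ 2 := by
      have := hP.length_le
      have := hQ.length_le
      nlinarith
    by_cases h1 : P.prod * Q.prod⁻¹ = 1
    · rw [h1, mul_one]
      refine (h.hasSLP.insert_mem hs).mono ?_ fun x hx => by simpa using hx
      simp only [List.length_cons]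
      omega
    · have h₁ := h.hasSLP.insert_prod_mul_prod_inv P Q (fun x hx => hP.subset hx)
        (fun x hx => hQ.subset hx) h1
      have h₂ := (h₁.insert_mem hs).insert_mul (Set.mem_insert _ _)
        (Set.mem_insert_of_mem _ (Set.mem_insert _ _))
      refine h₂.mono hlen fun x hx => ?_
      rcases List.mem_cons.1 hx with rfl | hx
      · exact Set.mem_insert _ _
      · exact Set.mem_insert_of_mem _ (Set.mem_insert_of_mem _ (Set.mem_insert_of_mem _ hx))
  nodup := by
    rw [List.sublists'_cons, List.map_append, List.nodup_append', List.map_map]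
    refine ⟨h.nodup, ?_, ?_⟩
    · have := h.nodup.map (mul_right_injective (s * (P.prod * Q.prod⁻¹)))
      rw [List.map_map] at this
      convert this using 2
      ext M
      simp
    · intro x hx hx'
      obtain ⟨P', hP', rfl⟩ := List.mem_map.1 hx
      obtain ⟨Q', hQ', h'⟩ := List.mem_map.1 hx'
      refine hz P' Q' (List.mem_sublists'.1 hP') (List.mem_sublists'.1 hQ') ?_
      rw [← h']
      simp

theorem two_pow_length_le [Finite G] (h : IsCubeBasis S L) :
    2 ^ L.length ≤ Nat.card (Subgroup.closure S) := by
  classical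
  rw [← List.length_sublists', ← List.length_map List.prod, ← List.toFinset_card_of_nodup h.nodup,
    ← Set.ncard_coe_finset, ← SetLike.coe_sort_coe, Nat.card_coe_set_eq]
  refine Set.ncard_le_ncard (fun x hx => ?_) (Set.toFinite _)
  obtain ⟨M, hM, rfl⟩ := List.mem_map.1 (List.mem_toFinset.1 (Finset.mem_coe.1 hx))
  exact Subgroup.list_prod_mem _ fun x hx =>
    h.mem_closure x ((List.mem_sublists'.1 hM).subset hx)

theorem exists_maximal [Finite G] (S : Set G) :
    ∃ L, IsCubeBasis S L ∧ ∀ L', IsCubeBasis S L' → L'.length ≤ L.length := by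
  have hfin : (List.length '' {L | IsCubeBasis S L}).Finite := by
    refine (Set.finite_Iic (Nat.card (Subgroup.closure S))).subset ?_
    rintro _ ⟨L, hL, rfl⟩
    exact Nat.lt_two_pow_self.le.trans hL.two_pow_length_le
  obtain ⟨_, ⟨L, hL, rfl⟩, hmax⟩ := hfin.exists_maximal ⟨_, Set.mem_image_of_mem _ (nil S)⟩
  refine ⟨L, hL, fun L' hL' => ?_⟩
  exact (le_total L'.length L.length).elim id (hmax (Set.mem_image_of_mem _ hL'))

theorem exists_eq_prod_mul_prod_inv [Finite G] (h : IsCubeBasis S L)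
    (hmax : ∀ L', IsCubeBasis S L' → L'.length ≤ L.length) {g : G}
    (hg : g ∈ Subgroup.closure S) :
    ∃ P Q : List G, P.Sublist L ∧ Q.Sublist L ∧ g = P.prod * Q.prod⁻¹ := by
  rw [← Subgroup.mem_toSubmonoid, Subgroup.closure_toSubmonoid_of_finite] at hg
  induction hg using Submonoid.closure_induction_left with
  | one => exact ⟨[], [], by simp, by simp, by simp⟩
  | mul_left s hs g _ ih =>
    obtain ⟨P, Q, hP, hQ, rfl⟩ := ih
    by_contra! hz
    simpa using hmax _ (h.cons hP hQ hs hz)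

end IsCubeBasis

/-- A quotient of two subproducts of a nonempty list `L` needs fewer than `2 * L.length` letters. -/
theorem exists_sublist_prod_mul_prod_inv_length_lt {G : Type*} [Group G] {L P Q : List G}
    (hL : L ≠ []) (hP : P.Sublist L) (hQ : Q.Sublist L) :
    ∃ P' Q' : List G, P'.Sublist L ∧ Q'.Sublist L ∧
      P.prod * Q.prod⁻¹ = P'.prod * Q'.prod⁻¹ ∧ P'.length + Q'.length < 2 * L.length := by
  by_cases hlt : P.length + Q.length < 2 * L.length
  · exact ⟨P, Q, hP, hQ, rfl, hlt⟩
  · have hPl := hP.length_le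
    have hQl := hQ.length_le
    obtain rfl := hP.eq_of_length (by omega)
    obtain rfl := hQ.eq_of_length (by omega)
    have := List.length_pos_of_ne_nil hL
    exact ⟨[], [], by simp, by simp, by simp, by simp; omega⟩

theorem le_two_pow_log₂ (m : ℕ) : m ≤ 2 ^ log₂ m :=
  Nat.sInf_mem (s := {r : ℕ | m ≤ 2 ^ r}) ⟨m, Nat.lt_two_pow_self.le⟩

/-- For a nonempty subset `S` of a finite group `G` with
`⟨S⟩` nontrivial and `σ = log |⟨S⟩|`, there is a pre-processing set `A ⊆ G`
with `|A| ≤ σ`, `⟨A⟩ = ⟨S⟩`, such that some SLP over `S` of reduced length at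
most `σ²` computes `A`, and every `g ∈ ⟨S⟩` is computed by some SLP over `A`
of reduced length at most `2σ - 1`. -/
theorem preprocessing_set_exists
    {G : Type*} [Group G] [Finite G] (S : Set G) (hS : S.Nonempty)
    (hnt : Subgroup.closure S ≠ ⊥) :
    ∃ A : Set G,
      A.ncard ≤ log₂ (Nat.card ↥(Subgroup.closure S)) ∧
      Subgroup.closure A = Subgroup.closure S ∧
      (∃ (n : ℕ) (y : Fin n → G), IsSLP S y ∧
        reducedLength S y ≤ (log₂ (Nat.card ↥(Subgroup.closure S))) ^ 2 ∧
        A ⊆ Set.range y) ∧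
      ∀ g ∈ Subgroup.closure S, ∃ (n : ℕ) (y : Fin n → G), IsSLP A y ∧
        reducedLength A y ≤ 2 * log₂ (Nat.card ↥(Subgroup.closure S)) - 1 ∧
        g ∈ Set.range y := by
  obtain ⟨L, hL, hmax⟩ := IsCubeBasis.exists_maximal S
  set N := Nat.card (Subgroup.closure S) with hN
  have hcard : N ≤ 2 ^ log₂ N := le_two_pow_log₂ N
  have hlen : L.length ≤ log₂ N :=
    (Nat.pow_le_pow_iff_right one_lt_two).1 (hL.two_pow_length_le.trans hcard)
  have hN1 : 1 < N := (Subgroup.one_lt_card_iff_ne_bot _).2 hnt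
  have hne : L ≠ [] := by
    rintro rfl
    refine hnt ((Subgroup.eq_bot_iff_forall _).2 fun g hg => ?_)
    obtain ⟨P, Q, hP, hQ, rfl⟩ := hL.exists_eq_prod_mul_prod_inv hmax hg
    simp [List.sublist_nil.1 hP, List.sublist_nil.1 hQ]
  have hbase : HasSLP {x | x ∈ L} 0 {x | x ∈ L} := HasSLP.of_list L fun x hx => hx
  refine ⟨{x | x ∈ L}, ?_, ?_,
    (hL.hasSLP.mono (Nat.pow_le_pow_left hlen 2) subset_rfl :), ?_⟩
  · classical
    rw [← List.coe_toFinset, Set.ncard_coe_finset]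
    exact (List.toFinset_card_le L).trans hlen
  · refine le_antisymm ((Subgroup.closure_le _).2 hL.mem_closure) fun g hg => ?_
    obtain ⟨P, Q, hP, hQ, rfl⟩ := hL.exists_eq_prod_mul_prod_inv hmax hg
    have hprod : ∀ M : List G, M.Sublist L → M.prod ∈ Subgroup.closure {x | x ∈ L} :=
      fun M hM => Subgroup.list_prod_mem _ fun x hx => Subgroup.subset_closure (hM.subset hx)
    exact mul_mem (hprod P hP) (inv_mem (hprod Q hQ))
  · intro g hg
    suffices h : HasSLP {x | x ∈ L} (2 * log₂ N - 1) {g} by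
      simpa [HasSLP] using h
    by_cases hg1 : g = 1
    · subst hg1
      obtain ⟨a, ha⟩ := List.exists_mem_of_ne_nil L hne
      by_cases hσ : log₂ N ≤ 1
      · have hN2 : N = 2 := by
          have := hcard.trans (Nat.pow_le_pow_right two_pos hσ)
          omega
        have haa : a * a = 1 := by
          rw [← pow_two, ← hN2, hN]
          have hpow := pow_card_eq_one'
            (x := (⟨a, hL.mem_closure a ha⟩ : Subgroup.closure S))
          exact congrArg Subtype.val hpow
        have hpos := List.length_pos_of_ne_nil hne
        refine (hbase.insert_mul ha ha).mono (by omega) ?_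
        simp [haa]
      · have h₁ := hbase.insert_inv (x := a) ha
        have h₂ := h₁.insert_mul (Set.mem_insert_of_mem a⁻¹ (show a ∈ {x | x ∈ L} from ha))
          (Set.mem_insert a⁻¹ _)
        refine h₂.mono (by omega) ?_
        simp
    · obtain ⟨P₀, Q₀, hP₀, hQ₀, rfl⟩ := hL.exists_eq_prod_mul_prod_inv hmax hg
      obtain ⟨P, Q, hP, hQ, heq, hlt⟩ :=
        exists_sublist_prod_mul_prod_inv_length_lt hne hP₀ hQ₀
      rw [heq] at hg1 ⊢
      refine (hbase.insert_prod_mul_prod_inv P Q (fun x hx => hP.subset hx)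
        (fun x hx => hQ.subset hx) hg1).mono (by omega) ?_
      simp
end

section
/- Every finite group G has a generating set A with |A| ≤ log |G| such that every element of G is the product of a list of at most 2·|A| elements, each of which lies in A or is the inverse of an element of A. -/
/-- `IsCubeFor A K` records the properties of the cube `K` of all subproducts of an enumeration
of `A` that are needed to reach every group element from `A`. -/
structure IsCubeFor {G : Type*} [Group G] (A K : Finset G) : Prop where
  card_eq : K.card = 2 ^ A.card
  one_mem : 1 ∈ K
  subset : A ⊆ K
  exists_list : ∀ k ∈ K, ∃ l : List G, (∀ x ∈ l, x ∈ A) ∧ l.length ≤ A.card ∧ l.prod = k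

/-- A cube `K` with `K⁻¹ K ≠ G` can be doubled. -/
theorem IsCubeFor.extend {G : Type*} [Group G] [DecidableEq G] {A K : Finset G}
    (h : IsCubeFor A K) {z : G} (hz : ∀ a ∈ K, ∀ b ∈ K, a⁻¹ * b ≠ z) :
    z ∉ A ∧ IsCubeFor (insert z A) (K ∪ K.image (· * z)) := by
  have hzA : z ∉ A := fun hA => hz 1 h.one_mem z (h.subset hA) (by simp)
  have hdisj : Disjoint K (K.image (· * z)) := by
    rw [Finset.disjoint_left]
    intro b hb hb'
    obtain ⟨a, ha, rfl⟩ := Finset.mem_image.1 hb'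
    exact hz a ha _ hb (by group)
  refine ⟨hzA, ?_, Finset.mem_union_left _ h.one_mem, ?_, ?_⟩
  · rw [Finset.card_union_of_disjoint hdisj,
      Finset.card_image_of_injective _ (mul_left_injective z), h.card_eq,
      Finset.card_insert_of_notMem hzA, pow_succ, mul_two]
  · refine Finset.insert_subset ?_ (h.subset.trans Finset.subset_union_left)
    exact Finset.mem_union_right _ (Finset.mem_image.2 ⟨1, h.one_mem, one_mul z⟩)
  · intro k hk
    rw [Finset.card_insert_of_notMem hzA]
    rcases Finset.mem_union.1 hk with hk | hk
    · obtain ⟨l, hl, hlen, rfl⟩ := h.exists_list k hk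
      exact ⟨l, fun x hx => Finset.mem_insert_of_mem (hl x hx), by lia, rfl⟩
    · obtain ⟨a, ha, rfl⟩ := Finset.mem_image.1 hk
      obtain ⟨l, hl, hlen, rfl⟩ := h.exists_list a ha
      refine ⟨l ++ [z], fun x hx => ?_, by simpa using hlen, by simp⟩
      rcases List.mem_append.1 hx with hx | hx
      · exact Finset.mem_insert_of_mem (hl x hx)
      · simp [List.mem_singleton.1 hx]

/-- Every finite group contains a cube `K` with `K⁻¹ K = G`. -/
theorem exists_isCubeFor_inv_mul_eq (G : Type*) [Group G] [Finite G] :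
    ∃ A K : Finset G, IsCubeFor A K ∧ ∀ g : G, ∃ a ∈ K, ∃ b ∈ K, a⁻¹ * b = g := by
  classical
  have hne : {p : Finset G × Finset G | IsCubeFor p.1 p.2}.Nonempty :=
    ⟨(∅, {1}), by simp, by simp, by simp, fun k hk => ⟨[], by simp_all⟩⟩
  obtain ⟨⟨A, K⟩, hAK, hmax⟩ :=
    Set.exists_max_image _ (fun p : Finset G × Finset G => p.1.card) (Set.toFinite _) hne
  refine ⟨A, K, hAK, ?_⟩
  by_contra! ⟨z, hz⟩
  obtain ⟨hzA, hext⟩ := IsCubeFor.extend hAK hz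
  have hle := hmax (_, _) hext
  simp only [Finset.card_insert_of_notMem hzA] at hle
  lia

theorem le_log₂_of_two_pow_le {t m : ℕ} (h : 2 ^ t ≤ m) : t ≤ log₂ m :=
  le_csInf ⟨m, Nat.lt_two_pow_self.le⟩ fun _ hr =>
    (Nat.pow_le_pow_iff_right one_lt_two).1 (h.trans hr)

/-- Every finite group `G` has a generating set `A` with
`|A| ≤ log |G|` such that every element of `G` is the product of a list of at
most `2|A|` elements, each lying in `A` or the inverse of an element of `A`. -/
theorem swift_generating_set_exists
    {G : Type*} [Group G] [Finite G] :
    ∃ A : Set G, Subgroup.closure A = ⊤ ∧ A.ncard ≤ log₂ (Nat.card G) ∧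
      ∀ g : G, ∃ l : List G, (∀ x ∈ l, x ∈ A ∨ x⁻¹ ∈ A) ∧
        l.length ≤ 2 * A.ncard ∧ l.prod = g := by
  obtain ⟨A, K, hAK, hK⟩ := exists_isCubeFor_inv_mul_eq G
  have hreach : ∀ g : G, ∃ l : List G, (∀ x ∈ l, x ∈ (A : Set G) ∨ x⁻¹ ∈ (A : Set G)) ∧
      l.length ≤ 2 * (A : Set G).ncard ∧ l.prod = g := by
    intro g
    obtain ⟨a, ha, b, hb, rfl⟩ := hK g
    obtain ⟨l, hl, hlen, rfl⟩ := hAK.exists_list a ha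
    obtain ⟨m, hm, hmlen, rfl⟩ := hAK.exists_list b hb
    refine ⟨(l.map (·⁻¹)).reverse ++ m, fun x hx => ?_, ?_, ?_⟩
    · rcases List.mem_append.1 hx with hx | hx
      · obtain ⟨y, hy, rfl⟩ := List.mem_map.1 (List.mem_reverse.1 hx)
        exact Or.inr (by simpa using hl y hy)
      · exact Or.inl (hm x hx)
    · simp only [Set.ncard_coe_finset, List.length_append, List.length_reverse, List.length_map]
      lia
    · rw [List.prod_append, List.prod_inv_reverse]
  refine ⟨A, ?_, ?_, hreach⟩
  · rw [eq_top_iff]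
    rintro g -
    obtain ⟨l, hl, -, rfl⟩ := hreach g
    refine Subgroup.list_prod_mem _ fun x hx => ?_
    rcases hl x hx with hx | hx
    · exact Subgroup.subset_closure hx
    · exact inv_mem_iff.1 (Subgroup.subset_closure hx)
  · rw [Set.ncard_coe_finset]
    apply le_log₂_of_two_pow_le
    rw [← hAK.card_eq, ← Set.ncard_coe_finset]
    exact Set.ncard_le_card _
end

section
/- Let p be a prime, let A be a finite abelian p-group, let X be a type, and let V be an additive subgroup of the additive group of functions X → A (with pointwise addition) such that V is generated by a set of at most d elements. Then there exists a finite subset Y of X with |Y| ≤ d such that every g ∈ V satisfying g(y) = 0 for all y ∈ Y is identically zero. -/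
/-- A finite group killed by `p`, of order at most `p ^ n`, whose points are separated from `0`
by a family of homomorphisms, already is separated from `0` by `n` members of the family. -/
theorem exists_finset_separating_of_card_le {p : ℕ} (hp : p.Prime) {A X : Type*} [AddCommGroup A]
    (n : ℕ) {G : Type*} [AddCommGroup G] [Finite G] (hG : ∀ g : G, p • g = 0)
    (hcard : Nat.card G ≤ p ^ n) (φ : X → G →+ A)
    (hφ : ∀ g, (∀ x, φ x g = 0) → g = 0) :
    ∃ Y : Finset X, Y.card ≤ n ∧ ∀ g, (∀ y ∈ Y, φ y g = 0) → g = 0 := by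
  classical
  suffices H : ∀ (n : ℕ) (W : AddSubgroup G), Nat.card W ≤ p ^ n →
      ∃ Y : Finset X, Y.card ≤ n ∧ ∀ g ∈ W, (∀ y ∈ Y, φ y g = 0) → g = 0 by
    obtain ⟨Y, hY, h⟩ := H n ⊤ (by simpa using hcard)
    exact ⟨Y, hY, fun g => h g (AddSubgroup.mem_top g)⟩
  intro n
  induction n with
  | zero =>
    intro W hW
    have hbot : W = ⊥ := AddSubgroup.eq_bot_of_card_le W (by simpa using hW)
    exact ⟨∅, by simp, fun g hg _ => by simpa [hbot] using hg⟩
  | succ n ih =>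
    intro W hW
    by_cases h0 : ∀ g ∈ W, ∀ x, φ x g = 0
    · exact ⟨∅, by simp, fun g hg _ => hφ g (h0 g hg)⟩
    push Not at h0
    obtain ⟨g, hg, x, hx⟩ := h0
    have hker : p ≤ ((φ x).ker.addSubgroupOf W).index := by
      let q : W ⧸ (φ x).ker.addSubgroupOf W := QuotientAddGroup.mk ⟨g, hg⟩
      have hq : addOrderOf q = p := by
        have : Fact p.Prime := ⟨hp⟩
        refine addOrderOf_eq_prime ?_ ?_
        · rw [← QuotientAddGroup.mk_nsmul, QuotientAddGroup.eq_zero_iff]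
          simp [AddSubgroup.mem_addSubgroupOf, hG]
        · simpa [q, QuotientAddGroup.eq_zero_iff, AddSubgroup.mem_addSubgroupOf] using hx
      rw [← hq]
      exact Nat.le_of_dvd Nat.card_pos (addOrderOf_dvd_natCard q)
    have hmul := ((φ x).ker.addSubgroupOf W).card_mul_index
    have hle : Nat.card ((φ x).ker ⊓ W : AddSubgroup G) ≤ p ^ n := by
      rw [← Nat.card_congr (((φ x).ker ⊓ W).addSubgroupOfEquivOfLe inf_le_right).toEquiv,
        AddSubgroup.inf_addSubgroupOf_right]
      refine Nat.le_of_mul_le_mul_right ?_ hp.pos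
      calc _ ≤ _ := Nat.mul_le_mul_left _ hker
        _ ≤ p ^ n * p := by rw [hmul, ← pow_succ]; exact hW
    obtain ⟨Y, hY, h⟩ := ih _ hle
    refine ⟨insert x Y, (Finset.card_insert_le _ _).trans (by lia), fun k hk hkY => ?_⟩
    exact h k ⟨hkY x (Finset.mem_insert_self _ _), hk⟩
      fun y hy => hkY y (Finset.mem_insert_of_mem hy)

/-- The `p`-torsion of a finite abelian group of rank `r` has at most `p ^ r` elements. -/
theorem card_ker_nsmul_le_pow_rank {p : ℕ} (hp : 0 < p) (G : Type*) [AddCommGroup G] [Finite G] :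
    Nat.card (nsmulAddMonoidHom (α := G) p).ker ≤ p ^ AddGroup.rank G := by
  set f := nsmulAddMonoidHom (α := G) p
  have hindex : Nat.card f.ker = f.range.index := by
    have h₁ := f.ker.card_mul_index
    rw [AddSubgroup.index_ker] at h₁
    have h₂ := f.range.card_mul_index
    rw [mul_comm] at h₂
    exact Nat.eq_of_mul_eq_mul_right Nat.card_pos (h₁.trans h₂.symm)
  rw [hindex]
  have hdvd : Nat.card (G ⧸ f.range) ∣ p ^ AddGroup.rank (G ⧸ f.range) := by
    refine card_dvd_exponent_nsmul_rank' _ fun q => ?_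
    obtain ⟨g, rfl⟩ := QuotientAddGroup.mk_surjective q
    rw [← QuotientAddGroup.mk_nsmul, QuotientAddGroup.eq_zero_iff]
    exact ⟨g, rfl⟩
  exact (Nat.le_of_dvd (pow_pos hp _) hdvd).trans
    (Nat.pow_le_pow_right hp (AddGroup.rank_le_of_surjective (QuotientAddGroup.mk' f.range)
      (QuotientAddGroup.mk'_surjective _)))


/-- Let `A` be a finite abelian `p`-group, `X` a type and `V`
a subgroup of `X → A` (pointwise addition) generated by at most `d` elements.
Then there is `Y ⊆ X` with `|Y| ≤ d` such that any `g ∈ V` vanishing on `Y`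
is identically zero. -/
theorem separating_set_pGroup
    {p : ℕ} (hp : p.Prime) {A : Type*} [AddCommGroup A] [Finite A]
    (hA : ∀ a : A, ∃ n : ℕ, p ^ n • a = 0)
    {X : Type*} (d : ℕ) (V : AddSubgroup (X → A))
    (T : Finset (X → A)) (hT : T.card ≤ d)
    (hTV : AddSubgroup.closure (↑T : Set (X → A)) = V) :
    ∃ Y : Finset X, Y.card ≤ d ∧
      ∀ g ∈ V, (∀ y ∈ Y, g y = 0) → g = 0 := by
  subst hTV
  obtain ⟨N, hN⟩ : ∃ N : ℕ, ∀ a : A, p ^ N • a = 0 := by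
    choose n hn using hA
    obtain ⟨N, hN⟩ := (Set.finite_range n).bddAbove
    refine ⟨N, fun a => ?_⟩
    rw [← Nat.sub_add_cancel (hN ⟨a, rfl⟩), pow_add, mul_nsmul', hn, nsmul_zero]
  set V := AddSubgroup.closure (T : Set (X → A))
  have hVN : ∀ g : V, p ^ N • g = 0 := fun g => by
    ext x
    exact hN _
  have : AddGroup.FG V := AddGroup.closure_finset_fg T
  have : Finite V := AddCommGroup.finite_of_fg_isAddTorsion V (fun g =>
    isOfFinAddOrder_iff_nsmul_eq_zero.2 ⟨p ^ N, pow_pos hp.pos N, hVN g⟩)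
  have hrank : AddGroup.rank V ≤ d := (AddSubgroup.rank_closure_finset_le_card T).trans hT
  obtain ⟨Y, hY, h⟩ := exists_finset_separating_of_card_le hp d
    (G := (nsmulAddMonoidHom (α := V) p).ker) (fun g => Subtype.ext g.2)
    ((card_ker_nsmul_le_pow_rank hp.pos V).trans (Nat.pow_le_pow_right hp.pos hrank))
    (fun x => ((Pi.evalAddMonoidHom (fun _ : X => A) x).comp V.subtype).comp
      (AddSubgroup.subtype _))
    (fun g hg => Subtype.ext (Subtype.ext (funext hg)))
  refine ⟨Y, hY, fun g hg hgY => ?_⟩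
  have hpow : ∀ n : ℕ, p ^ n • (⟨g, hg⟩ : V) = 0 → (⟨g, hg⟩ : V) = 0 := by
    intro n
    induction n with
    | zero => simp
    | succ n ih =>
      intro hn
      refine ih (congrArg Subtype.val (h ⟨p ^ n • ⟨g, hg⟩, ?_⟩ fun y hy => ?_))
      · rw [pow_succ, mul_nsmul] at hn
        exact hn
      · change p ^ n • g y = 0
        rw [hgY y hy, nsmul_zero]
  exact congrArg Subtype.val (hpow N (hVN _))
end

section
/- Let A be a finite abelian group, let X be a type, and let V be an additive subgroup of the additive group of functions X → A (with pointwise addition) such that V is generated by a set of at most d elements. Then there exists a finite subset Y of X with |Y| ≤ d·λ(|A|) such that every g ∈ V satisfying g(y) = 0 for all y ∈ Y is identically zero. -/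
/-- `Ω n`: the number of prime factors of `n` counted with multiplicity. -/
def primeFactorCount (n : ℕ) : ℕ := (Nat.primeFactorsList n).length

theorem primeFactorCount_mul {m n : ℕ} (hm : m ≠ 0) (hn : n ≠ 0) :
    primeFactorCount (m * n) = primeFactorCount m + primeFactorCount n :=
  ArithmeticFunction.cardFactors_mul hm hn

theorem primeFactorCount_pow (n k : ℕ) :
    primeFactorCount (n ^ k) = k * primeFactorCount n :=
  ArithmeticFunction.cardFactors_pow

theorem primeFactorCount_le_of_dvd {m n : ℕ} (hn : n ≠ 0) (h : m ∣ n) :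
    primeFactorCount m ≤ primeFactorCount n := by
  obtain ⟨k, rfl⟩ := h
  rw [primeFactorCount_mul (left_ne_zero_of_mul hn) (right_ne_zero_of_mul hn)]
  exact Nat.le_add_right _ _

theorem primeFactorCount_pos {n : ℕ} (hn : 1 < n) : 0 < primeFactorCount n := by
  rw [primeFactorCount, List.length_pos_iff, Ne, Nat.primeFactorsList_eq_nil]
  omega

/-- A proper subgroup of a finite group has an order with strictly fewer prime factors. -/
theorem primeFactorCount_card_lt {G : Type*} [AddGroup G] {H K : AddSubgroup G} [Finite K]
    (h : H < K) : primeFactorCount (Nat.card H) < primeFactorCount (Nat.card K) := by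
  have hmul : Nat.card H * H.relIndex K = Nat.card K := by
    simpa only [AddSubgroup.relIndex_bot_left] using
      AddSubgroup.relIndex_mul_relIndex ⊥ H K bot_le h.le
  have hK : Nat.card K ≠ 0 := Nat.card_pos.ne'
  rw [← hmul] at hK
  have h_ne_one : H.relIndex K ≠ 1 := fun h1 => h.not_ge (AddSubgroup.relIndex_eq_one.mp h1)
  have h_ne_zero : H.relIndex K ≠ 0 := right_ne_zero_of_mul hK
  rw [← hmul, primeFactorCount_mul (left_ne_zero_of_mul hK) h_ne_zero]
  have := primeFactorCount_pos (n := H.relIndex K) (by omega)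
  omega

/-- The order of a subgroup generated by a finite set `T` of elements killed by `n` divides
`n ^ #T`. -/
theorem card_closure_dvd_pow {G : Type*} [AddCommGroup G] {n : ℕ} (hn : ∀ g : G, n • g = 0)
    (T : Finset G) : Nat.card (AddSubgroup.closure (T : Set G)) ∣ n ^ T.card := by
  classical
  induction T using Finset.induction_on with
  | empty => simp
  | insert a T ha ih =>
    rw [Finset.coe_insert, Set.insert_eq, AddSubgroup.closure_union, Finset.card_insert_of_notMem ha,
      pow_succ]
    set K := AddSubgroup.closure (T : Set G)
    set H := AddSubgroup.closure ({a} : Set G) with hH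
    have hmul : Nat.card K * K.relIndex H = Nat.card (H ⊔ K : AddSubgroup G) := by
      simpa only [AddSubgroup.relIndex_bot_left, AddSubgroup.relIndex_sup_right] using
        AddSubgroup.relIndex_mul_relIndex ⊥ K (H ⊔ K) bot_le le_sup_right
    rw [← hmul]
    refine mul_dvd_mul ih ((AddSubgroup.index_dvd_card _).trans ?_)
    rw [hH, ← AddSubgroup.zmultiples_eq_closure, Nat.card_zmultiples]
    exact addOrderOf_dvd_of_nsmul_eq_zero (hn a)

/-- A finite group `W` of functions is separated from zero by at most `Ω(|W|)` points. -/
theorem exists_separating_finset {A X : Type*} [AddCommGroup A] (W : AddSubgroup (X → A))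
    [Finite W] : ∃ Y : Finset X, Y.card ≤ primeFactorCount (Nat.card W) ∧
      ∀ g ∈ W, (∀ y ∈ Y, g y = 0) → g = 0 := by
  classical
  induction hk : primeFactorCount (Nat.card W) using Nat.strong_induction_on generalizing W with
  | _ k ih =>
    by_cases hW : ∀ g ∈ W, g = 0
    · exact ⟨∅, by simp, fun g hg _ => hW g hg⟩
    push Not at hW
    obtain ⟨f, hf, hf0⟩ := hW
    obtain ⟨x, hx⟩ := Function.ne_iff.mp hf0
    let U := W ⊓ (Pi.evalAddMonoidHom (fun _ : X => A) x).ker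
    have hU : U < W := lt_of_le_of_ne inf_le_left fun h => hx (h.ge hf).2
    have : Finite U := Finite.of_injective _ (AddSubgroup.inclusion_injective hU.le)
    have hlt := primeFactorCount_card_lt hU
    obtain ⟨Y, hY, hsep⟩ := ih _ (hk ▸ hlt) U rfl
    refine ⟨insert x Y, (Finset.card_insert_le x Y).trans (by omega), fun g hg h => ?_⟩
    exact hsep g ⟨hg, h x (Finset.mem_insert_self x Y)⟩
      fun y hy => h y (Finset.mem_insert_of_mem hy)

/-- Let `A` be a finite abelian group, `X` a type and `V` a
subgroup of `X → A` (pointwise addition) generated by at most `d` elements.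
Then there is `Y ⊆ X` with `|Y| ≤ d·λ(|A|)` such that any `g ∈ V` vanishing
on `Y` is identically zero. -/
theorem separating_set_abelian
    {A : Type*} [AddCommGroup A] [Finite A]
    {X : Type*} (d : ℕ) (V : AddSubgroup (X → A))
    (T : Finset (X → A)) (hT : T.card ≤ d)
    (hTV : AddSubgroup.closure (↑T : Set (X → A)) = V) :
    ∃ Y : Finset X, Y.card ≤ d * primeFactorCount (Nat.card A) ∧
      ∀ g ∈ V, (∀ y ∈ Y, g y = 0) → g = 0 := by
  have hA : Nat.card A ≠ 0 := Nat.card_pos.ne'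
  have hdvd : Nat.card V ∣ Nat.card A ^ T.card := by
    rw [← hTV]
    exact card_closure_dvd_pow (fun g => funext fun x => card_nsmul_eq_zero') T
  have hpow : Nat.card A ^ T.card ≠ 0 := pow_ne_zero _ hA
  have : Finite V := Nat.finite_of_card_ne_zero (ne_zero_of_dvd_ne_zero hpow hdvd)
  obtain ⟨Y, hY, hsep⟩ := exists_separating_finset V
  refine ⟨Y, hY.trans ((primeFactorCount_le_of_dvd hpow hdvd).trans ?_), hsep⟩
  rw [primeFactorCount_pow]
  exact Nat.mul_le_mul_right _ hT
end

section
/- Let n ≥ 1 and let p : Fin n → ℕ be pairwise distinct primes. Let A be the product group ∀ i, ZMod (p i), and define f : Fin n → A by (f x) i = 1 if i = x and (f x) i = 0 otherwise. Let V be the additive subgroup of the function group Fin n → A generated by the single element f. If Y is a subset of Fin n such that every g ∈ V with g(y) = 0 for all y ∈ Y is identically zero, then Y is all of Fin n. (In particular, V is generated by d = 1 element, λ(|A|) = n, and no separating set Y of size smaller than d·λ(|A|) exists, so the bound d·λ(|A|) is optimal.) -/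
/-- optimality of the bound `d·λ(|A|)`. Let `p i`,
`i < n`, be pairwise distinct primes, `A = ∀ i, ZMod (p i)` and
`f : Fin n → A` with `(f x) i = 1` if `i = x` and `0` otherwise. If `Y` is a
subset of `Fin n` such that every `g` in the subgroup generated by `f`
vanishing on `Y` is identically zero, then `Y = Fin n`. -/
theorem separating_set_bound_optimal
    (n : ℕ) (hn : 1 ≤ n) (p : Fin n → ℕ) (hp : ∀ i, (p i).Prime)
    (hinj : Function.Injective p)
    (f : Fin n → (∀ i, ZMod (p i)))
    (hf : ∀ x i, f x i = if i = x then 1 else 0)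
    (Y : Set (Fin n))
    (hY : ∀ g ∈ AddSubgroup.closure {f}, (∀ y ∈ Y, g y = 0) → g = 0) :
    Y = Set.univ := by
  classical
  refine Set.eq_univ_of_forall fun x => by_contra fun hx => ?_
  set N := ∏ j ∈ Finset.univ.erase x, p j
  have hg := hY (N • f) (nsmul_mem (AddSubgroup.mem_closure_singleton_self f) N) ?_
  · have hdvd : p x ∣ N := by
      rw [← ZMod.natCast_eq_zero_iff]
      simpa [hf] using congrFun (congrFun hg x) x
    obtain ⟨j, hj, hxj⟩ := ((hp x).prime.dvd_finsetProd_iff p).1 hdvd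
    exact Finset.ne_of_mem_erase hj (hinj ((Nat.prime_dvd_prime_iff_eq (hp x) (hp j)).1 hxj)).symm
  · intro y hy
    funext i
    rcases eq_or_ne i y with rfl | hi
    · have hne : i ≠ x := fun h => hx (h ▸ hy)
      have hdvd : p i ∣ N := Finset.dvd_prod_of_mem p (Finset.mem_erase.2 ⟨hne, Finset.mem_univ i⟩)
      simpa [hf] using (ZMod.natCast_eq_zero_iff N (p i)).2 hdvd
    · simp [hf, hi]
end

section
/- Let N and H be groups, k a natural number, s : Fin k → H a family whose range generates H, and let (E₁, ι₁, π₁, t₁) and (E₂, ι₂, π₂, t₂) be extension data for (N, H, s) inducing the same action. Then there exists a group isomorphism f : E₁ ≃* E₂ with f(ι₁ a) = ι₂ a for all a ∈ N and f(t₁ i) = t₂ i for all i, if and only if for every relator w there exists a ∈ N with lift t₁ w = ι₁ a and lift t₂ w = ι₂ a. -/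
/-- An extension datum for `(N, H, s)`: a group `E`, an injective
homomorphism `ι : N →* E` with normal range, a surjective homomorphism
`π : E →* H` with kernel equal to the range of `ι`, and lifts `t i` of the
generators `s i`. -/
def IsExtensionDatum {N H E : Type*} [Group N] [Group H] [Group E]
    {k : ℕ} (s : Fin k → H) (ι : N →* E) (π : E →* H) (t : Fin k → E) : Prop :=
  Function.Injective ι ∧ ι.range.Normal ∧ Function.Surjective π ∧
    π.ker = ι.range ∧ ∀ i, π (t i) = s i

/-- Two extension data induce the same action on `N`. -/
def SameAction {N E₁ E₂ : Type*} [Group N] [Group E₁] [Group E₂] {k : ℕ}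
    (ι₁ : N →* E₁) (t₁ : Fin k → E₁) (ι₂ : N →* E₂) (t₂ : Fin k → E₂) : Prop :=
  ∀ (a : N) (i : Fin k), ∃ b : N,
    t₁ i * ι₁ a * (t₁ i)⁻¹ = ι₁ b ∧ t₂ i * ι₂ a * (t₂ i)⁻¹ = ι₂ b

theorem FreeGroup.lift_prodMk {α G K : Type*} [Group G] [Group K] (t : α → G) (u : α → K)
    (w : FreeGroup α) :
    FreeGroup.lift (fun i => (t i, u i)) w = (FreeGroup.lift t w, FreeGroup.lift u w) := by
  have h : FreeGroup.lift (fun i => (t i, u i)) =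
      (FreeGroup.lift t).prod (FreeGroup.lift u) := by
    ext i <;> simp
  rw [h, MonoidHom.prod_apply]

namespace IsExtensionDatum

variable {N H E : Type*} [Group N] [Group H] [Group E] {k : ℕ} {s : Fin k → H}
  {ι : N →* E} {π : E →* H} {t : Fin k → E}

theorem map_ι (h : IsExtensionDatum s ι π t) (a : N) : π (ι a) = 1 := by
  rw [← MonoidHom.mem_ker, h.2.2.2.1]
  exact ⟨a, rfl⟩

theorem exists_ι_eq (h : IsExtensionDatum s ι π t) {e : E} (he : π e = 1) :
    ∃ a, ι a = e := by
  rwa [← MonoidHom.mem_ker, h.2.2.2.1] at he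

theorem map_lift (h : IsExtensionDatum s ι π t) (w : FreeGroup (Fin k)) :
    π (FreeGroup.lift t w) = FreeGroup.lift s w := by
  have hcomp : π.comp (FreeGroup.lift t) = FreeGroup.lift s := by
    ext i
    simp [h.2.2.2.2 i]
  exact DFunLike.congr_fun hcomp w

theorem exists_ι_mul_lift_eq (h : IsExtensionDatum s ι π t)
    (hs : Subgroup.closure (Set.range s) = ⊤) (e : E) :
    ∃ a w, ι a * FreeGroup.lift t w = e := by
  obtain ⟨w, hw⟩ := FreeGroup.lift_surjective_iff_closure_range_eq_top.2 hs (π e)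
  obtain ⟨a, ha⟩ := h.exists_ι_eq (e := e * (FreeGroup.lift t w)⁻¹) (by
    rw [map_mul, map_inv, h.map_lift, hw, mul_inv_cancel])
  exact ⟨a, w, by rw [ha, inv_mul_cancel_right]⟩

end IsExtensionDatum

section Diagonal

variable {N H E₁ E₂ : Type*} [Group N] [Group H] [Group E₁] [Group E₂] {k : ℕ}
  {s : Fin k → H} {ι₁ : N →* E₁} {π₁ : E₁ →* H} {t₁ : Fin k → E₁}
  {ι₂ : N →* E₂} {π₂ : E₂ →* H} {t₂ : Fin k → E₂}

theorem SameAction.mem_normalizer_range_prod (hact : SameAction ι₁ t₁ ι₂ t₂)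
    (h₁ : IsExtensionDatum s ι₁ π₁ t₁) (i : Fin k) :
    (t₁ i, t₂ i) ∈ Subgroup.normalizer ((ι₁.prod ι₂).range : Set (E₁ × E₂)) := by
  rw [Subgroup.mem_normalizer_iff]
  rintro ⟨x, y⟩
  simp only [MonoidHom.mem_range, MonoidHom.prod_apply, Prod.mk.injEq, Prod.mk_mul_mk,
    Prod.inv_mk]
  constructor
  · rintro ⟨a, rfl, rfl⟩
    obtain ⟨b, hb₁, hb₂⟩ := hact a i
    exact ⟨b, hb₁.symm, hb₂.symm⟩
  · rintro ⟨b, hb₁, hb₂⟩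
    obtain ⟨a, rfl⟩ := h₁.exists_ι_eq (e := x) <| by
      simpa [h₁.map_ι] using (congrArg π₁ hb₁).symm
    obtain ⟨c, hc₁, hc₂⟩ := hact a i
    obtain rfl : b = c := h₁.1 (hb₁.trans hc₁)
    exact ⟨a, rfl, mul_left_cancel (mul_right_cancel (hc₂.trans hb₂))⟩

theorem SameAction.mem_range_sup_range_iff (hact : SameAction ι₁ t₁ ι₂ t₂)
    (h₁ : IsExtensionDatum s ι₁ π₁ t₁) {p : E₁ × E₂} :
    p ∈ (ι₁.prod ι₂).range ⊔ (FreeGroup.lift fun i => (t₁ i, t₂ i)).range ↔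
      ∃ a w, (ι₁ a * FreeGroup.lift t₁ w, ι₂ a * FreeGroup.lift t₂ w) = p := by
  have hle : (FreeGroup.lift fun i => (t₁ i, t₂ i)).range ≤
      Subgroup.normalizer ((ι₁.prod ι₂).range : Set (E₁ × E₂)) :=
    FreeGroup.range_lift_le (Set.range_subset_iff.2 (hact.mem_normalizer_range_prod h₁))
  rw [← SetLike.mem_coe, Subgroup.coe_mul_of_right_le_normalizer_left _ _ hle, Set.mem_mul]
  simp [FreeGroup.lift_prodMk]

theorem IsExtensionDatum.ι_mul_lift_eq_one (h₁ : IsExtensionDatum s ι₁ π₁ t₁)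
    (hrel : ∀ w, FreeGroup.lift s w = 1 →
      ∃ a : N, FreeGroup.lift t₁ w = ι₁ a ∧ FreeGroup.lift t₂ w = ι₂ a)
    {a : N} {w : FreeGroup (Fin k)} (h : ι₁ a * FreeGroup.lift t₁ w = 1) :
    ι₂ a * FreeGroup.lift t₂ w = 1 := by
  have hw : FreeGroup.lift s w = 1 := by
    simpa [h₁.map_ι, h₁.map_lift] using congrArg π₁ h
  obtain ⟨b, hb₁, hb₂⟩ := hrel w hw
  rw [hb₁, ← map_mul, map_eq_one_iff ι₁ h₁.1] at h
  rw [hb₂, ← map_mul, h, map_one]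

end Diagonal

/-- Two extension data of `N` by `H` inducing the same
action are isomorphic over `N` respecting the lifts iff the two lifts agree
(in `N`) on every relator. -/
theorem extensions_isomorphic_iff_relators_agree
    {N H E₁ E₂ : Type*} [Group N] [Group H] [Group E₁] [Group E₂]
    {k : ℕ} (s : Fin k → H) (hs : Subgroup.closure (Set.range s) = ⊤)
    (ι₁ : N →* E₁) (π₁ : E₁ →* H) (t₁ : Fin k → E₁)
    (ι₂ : N →* E₂) (π₂ : E₂ →* H) (t₂ : Fin k → E₂)
    (h₁ : IsExtensionDatum s ι₁ π₁ t₁) (h₂ : IsExtensionDatum s ι₂ π₂ t₂)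
    (hact : SameAction ι₁ t₁ ι₂ t₂) :
    (∃ f : E₁ ≃* E₂, (∀ a : N, f (ι₁ a) = ι₂ a) ∧ ∀ i, f (t₁ i) = t₂ i) ↔
      ∀ w : FreeGroup (Fin k), FreeGroup.lift s w = 1 →
        ∃ a : N, FreeGroup.lift t₁ w = ι₁ a ∧ FreeGroup.lift t₂ w = ι₂ a := by
  constructor
  · rintro ⟨f, hfι, hft⟩ w hw
    obtain ⟨a, ha⟩ := h₁.exists_ι_eq ((h₁.map_lift w).trans hw)
    have hcomp : f.toMonoidHom.comp (FreeGroup.lift t₁) = FreeGroup.lift t₂ := by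
      ext i
      simp [hft i]
    refine ⟨a, ha.symm, ?_⟩
    rw [← hcomp, ← hfι a, ha]
    rfl
  · intro hrel
    have hrel' : ∀ w, FreeGroup.lift s w = 1 →
        ∃ a : N, FreeGroup.lift t₂ w = ι₂ a ∧ FreeGroup.lift t₁ w = ι₁ a :=
      fun w hw => (hrel w hw).imp fun _ => And.symm
    let D := (ι₁.prod ι₂).range ⊔ (FreeGroup.lift fun i => (t₁ i, t₂ i)).range
    have hD {p : E₁ × E₂} : p ∈ D ↔
        ∃ a w, (ι₁ a * FreeGroup.lift t₁ w, ι₂ a * FreeGroup.lift t₂ w) = p :=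
      hact.mem_range_sup_range_iff h₁
    have hfst : Function.Bijective (Prod.fst ∘ D.subtype) := by
      refine ⟨(injective_iff_map_eq_one ((MonoidHom.fst E₁ E₂).comp D.subtype)).2 ?_,
        fun e => ?_⟩
      · rintro ⟨p, hp⟩ h
        obtain ⟨a, w, rfl⟩ := hD.1 hp
        exact Subtype.ext (Prod.ext h (h₁.ι_mul_lift_eq_one hrel h))
      · obtain ⟨a, w, rfl⟩ := h₁.exists_ι_mul_lift_eq hs e
        exact ⟨⟨_, hD.2 ⟨a, w, rfl⟩⟩, rfl⟩
    have hsnd : Function.Bijective (Prod.snd ∘ D.subtype) := by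
      refine ⟨(injective_iff_map_eq_one ((MonoidHom.snd E₁ E₂).comp D.subtype)).2 ?_,
        fun e => ?_⟩
      · rintro ⟨p, hp⟩ h
        obtain ⟨a, w, rfl⟩ := hD.1 hp
        exact Subtype.ext (Prod.ext (h₂.ι_mul_lift_eq_one hrel' h) h)
      · obtain ⟨a, w, rfl⟩ := h₂.exists_ι_mul_lift_eq hs e
        exact ⟨⟨_, hD.2 ⟨a, w, rfl⟩⟩, rfl⟩
    obtain ⟨f, hf⟩ := Subgroup.exists_mulEquiv_eq_graph hfst hsnd
    have hgraph {p : E₁ × E₂} (hp : p ∈ D) : f p.1 = p.2 := by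
      rw [hf] at hp
      exact hp
    refine ⟨f, fun a => hgraph (p := (ι₁ a, ι₂ a)) (hD.2 ⟨a, 1, by simp⟩),
      fun i => hgraph (p := (t₁ i, t₂ i)) (hD.2 ⟨1, FreeGroup.of i, by simp⟩)⟩
end

section
/- Let N and H be groups, k a natural number, s : Fin k → H a family whose range generates H, and m a natural number such that every element of H equals lift s w for some word w with FreeGroup.norm w ≤ m. Let (E₁, ι₁, π₁, t₁) and (E₂, ι₂, π₂, t₂) be extension data for (N, H, s) inducing the same action. If for every relator w with FreeGroup.norm w ≤ 3m there exists a ∈ N with lift t₁ w = ι₁ a and lift t₂ w = ι₂ a, then there is a group isomorphism f : E₁ ≃* E₂ with f(ι₁ a) = ι₂ a for all a ∈ N. -/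
section ExtensionData

variable {N H E E₁ E₂ : Type*} [Group N] [Group H] [Group E] [Group E₁] [Group E₂] {k : ℕ}
  {s : Fin k → H}

theorem IsExtensionDatum.map_lift_s9 {ι : N →* E} {π : E →* H} {t : Fin k → E}
    (h : IsExtensionDatum s ι π t) (w : FreeGroup (Fin k)) :
    π (FreeGroup.lift t w) = FreeGroup.lift s w := by
  have key : π.comp (FreeGroup.lift t) = FreeGroup.lift s := by
    ext i
    simpa using h.2.2.2.2 i
  exact DFunLike.congr_fun key w

theorem IsExtensionDatum.map_eq_one_iff {ι : N →* E} {π : E →* H} {t : Fin k → E}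
    (h : IsExtensionDatum s ι π t) {x : E} : π x = 1 ↔ ∃ a, ι a = x := by
  rw [← MonoidHom.mem_ker, h.2.2.2.1, MonoidHom.mem_range]

/-- Data inducing the same action for the generators do so for all words. -/
theorem SameAction.lift {ι₁ : N →* E₁} {t₁ : Fin k → E₁} {ι₂ : N →* E₂} {t₂ : Fin k → E₂}
    (hact : SameAction ι₁ t₁ ι₂ t₂) (hinj : Function.Injective ι₁) (hnormal : ι₁.range.Normal)
    (w : FreeGroup (Fin k)) (a : N) :
    ∃ b, FreeGroup.lift t₁ w * ι₁ a * (FreeGroup.lift t₁ w)⁻¹ = ι₁ b ∧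
      FreeGroup.lift t₂ w * ι₂ a * (FreeGroup.lift t₂ w)⁻¹ = ι₂ b := by
  induction w generalizing a with
  | C1 => exact ⟨a, by simp⟩
  | of i => simpa using hact a i
  | inv_of i _ =>
    obtain ⟨b, hb⟩ := hnormal.conj_mem (ι₁ a) ⟨a, rfl⟩ (t₁ i)⁻¹
    obtain ⟨c, hc₁, hc₂⟩ := hact b i
    obtain rfl : a = c := hinj (by rw [← hc₁, hb]; group)
    refine ⟨b, by simp [hb], ?_⟩
    rw [← hc₂]
    simp [mul_assoc]
  | mul x y hx hy =>
    obtain ⟨b, hb₁, hb₂⟩ := hy a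
    obtain ⟨c, hc₁, hc₂⟩ := hx b
    refine ⟨c, ?_, ?_⟩
    · rw [← hc₁, ← hb₁, map_mul]; group
    · rw [← hc₂, ← hb₂, map_mul]; group

/-- A homomorphism of extensions inducing the identity on kernel and quotient is bijective. -/
theorem IsExtensionDatum.bijective_of_comm {ι₁ : N →* E₁} {π₁ : E₁ →* H} {t₁ : Fin k → E₁}
    {ι₂ : N →* E₂} {π₂ : E₂ →* H} {t₂ : Fin k → E₂}
    (h₁ : IsExtensionDatum s ι₁ π₁ t₁) (h₂ : IsExtensionDatum s ι₂ π₂ t₂) (f : E₁ →* E₂)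
    (hι : ∀ a, f (ι₁ a) = ι₂ a) (hπ : ∀ x, π₂ (f x) = π₁ x) : Function.Bijective f := by
  constructor
  · rw [injective_iff_map_eq_one]
    intro x hx
    obtain ⟨a, rfl⟩ := h₁.map_eq_one_iff.1 (show π₁ x = 1 by rw [← hπ, hx, map_one])
    rw [hι, ← map_one ι₂] at hx
    rw [h₂.1 hx, map_one]
  · intro y
    obtain ⟨x, hx⟩ := h₁.2.2.1 (π₂ y)
    obtain ⟨a, ha⟩ := h₂.map_eq_one_iff.1
      (show π₂ (y * (f x)⁻¹) = 1 by rw [map_mul, map_inv, hπ, hx, mul_inv_cancel])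
    exact ⟨ι₁ a * x, by rw [map_mul, hι, ha, inv_mul_cancel_right]⟩

/-- Extension data inducing the same action, whose values agree on the relators coming from a
section `r` of `H` in the free group, admit a homomorphism over `N` and `H`. -/
theorem IsExtensionDatum.exists_hom {ι₁ : N →* E₁} {π₁ : E₁ →* H} {t₁ : Fin k → E₁}
    {ι₂ : N →* E₂} {π₂ : E₂ →* H} {t₂ : Fin k → E₂}
    (h₁ : IsExtensionDatum s ι₁ π₁ t₁) (h₂ : IsExtensionDatum s ι₂ π₂ t₂)
    (hact : SameAction ι₁ t₁ ι₂ t₂) (r : H → FreeGroup (Fin k))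
    (hr : ∀ h, FreeGroup.lift s (r h) = h)
    (hone : ∃ a, FreeGroup.lift t₁ (r 1) = ι₁ a ∧ FreeGroup.lift t₂ (r 1) = ι₂ a)
    (hmul : ∀ g h, ∃ a, FreeGroup.lift t₁ (r g * r h * (r (g * h))⁻¹) = ι₁ a ∧
      FreeGroup.lift t₂ (r g * r h * (r (g * h))⁻¹) = ι₂ a) :
    ∃ f : E₁ →* E₂, (∀ a, f (ι₁ a) = ι₂ a) ∧ ∀ x, π₂ (f x) = π₁ x := by
  have hdecomp (x : E₁) : ∃ a, ι₁ a = x * (FreeGroup.lift t₁ (r (π₁ x)))⁻¹ :=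
    h₁.map_eq_one_iff.1 (by rw [map_mul, map_inv, h₁.map_lift_s9, hr, mul_inv_cancel])
  choose c hc using hdecomp
  have hπι₁ (a : N) : π₁ (ι₁ a) = 1 := h₁.map_eq_one_iff.2 ⟨a, rfl⟩
  have hπι₂ (a : N) : π₂ (ι₂ a) = 1 := h₂.map_eq_one_iff.2 ⟨a, rfl⟩
  have hc_mul (x y : E₁) : ι₂ (c (x * y)) * FreeGroup.lift t₂ (r (π₁ (x * y))) =
      ι₂ (c x) * FreeGroup.lift t₂ (r (π₁ x)) * (ι₂ (c y) * FreeGroup.lift t₂ (r (π₁ y))) := by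
    obtain ⟨b, hb₁, hb₂⟩ := hact.lift h₁.1 h₁.2.1 (r (π₁ x)) (c y)
    obtain ⟨d, hd₁, hd₂⟩ := hmul (π₁ x) (π₁ y)
    have hcxy : c (x * y) = c x * b * d := by
      apply h₁.1
      rw [map_mul, map_mul, hc, hc, ← hb₁, ← hd₁, hc]
      simp only [map_mul, map_inv]
      group
    rw [hcxy, map_mul ι₂, map_mul ι₂, ← hb₂, ← hd₂]
    simp only [map_mul, map_inv]
    group
  refine ⟨MonoidHom.mk' (fun x ↦ ι₂ (c x) * FreeGroup.lift t₂ (r (π₁ x))) hc_mul, ?_, ?_⟩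
  · intro a
    obtain ⟨d, hd₁, hd₂⟩ := hone
    have hca : c (ι₁ a) = a * d⁻¹ := by
      apply h₁.1
      rw [hc, hπι₁, hd₁, map_mul, map_inv]
    simp [hca, hπι₁, hd₂]
  · intro x
    simp [hπι₂, h₂.map_lift_s9, hr]

end ExtensionData

/-- If every element of `H` is a word of length at most `m`
in `s`, and two extension data of `N` by `H` inducing the same action agree
(in `N`) on all relators of length at most `3m`, then the extensions are
isomorphic over `N`. -/
theorem extensions_isomorphic_of_short_relators_agree
    {N H E₁ E₂ : Type*} [Group N] [Group H] [Group E₁] [Group E₂]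
    {k : ℕ} (s : Fin k → H) (hs : Subgroup.closure (Set.range s) = ⊤)
    (m : ℕ)
    (hm : ∀ h : H, ∃ w : FreeGroup (Fin k),
      FreeGroup.norm w ≤ m ∧ FreeGroup.lift s w = h)
    (ι₁ : N →* E₁) (π₁ : E₁ →* H) (t₁ : Fin k → E₁)
    (ι₂ : N →* E₂) (π₂ : E₂ →* H) (t₂ : Fin k → E₂)
    (h₁ : IsExtensionDatum s ι₁ π₁ t₁) (h₂ : IsExtensionDatum s ι₂ π₂ t₂)
    (hact : SameAction ι₁ t₁ ι₂ t₂)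
    (hrel : ∀ w : FreeGroup (Fin k), FreeGroup.lift s w = 1 →
      FreeGroup.norm w ≤ 3 * m →
      ∃ a : N, FreeGroup.lift t₁ w = ι₁ a ∧ FreeGroup.lift t₂ w = ι₂ a) :
    ∃ f : E₁ ≃* E₂, ∀ a : N, f (ι₁ a) = ι₂ a := by
  choose r hrm hr using hm
  have hone := hrel (r 1) (hr 1) ((hrm 1).trans (by lia))
  have hmul (g h : H) := hrel (r g * r h * (r (g * h))⁻¹) (by simp [hr]) (by
    have hl := FreeGroup.norm_mul_le (r g * r h) (r (g * h))⁻¹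
    have hl' := FreeGroup.norm_mul_le (r g) (r h)
    rw [FreeGroup.norm_inv_eq] at hl
    linarith [hrm g, hrm h, hrm (g * h)])
  obtain ⟨f, hι, hπ⟩ := h₁.exists_hom h₂ hact r hr hone hmul
  exact ⟨MulEquiv.ofBijective f (h₁.bijective_of_comm h₂ f hι hπ), hι⟩
end

section
/- Let N be a group with trivial center, H a group, k a natural number, s : Fin k → H a family whose range generates H, and let (E₁, ι₁, π₁, t₁) and (E₂, ι₂, π₂, t₂) be extension data for (N, H, s) inducing the same action. Then there is a group isomorphism f : E₁ ≃* E₂ with f(ι₁ a) = ι₂ a for all a ∈ N and f(t₁ i) = t₂ i for all i. -/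
/-- Conjugation by the ambient group on a normally embedded subgroup, as automorphisms. -/
theorem exists_conj_action {N E : Type*} [Group N] [Group E] (ι : N →* E)
    (hι : Function.Injective ι) (hn : ι.range.Normal) :
    ∃ φ : E →* MulAut N, ∀ g a, ι (φ g a) = g * ι a * g⁻¹ := by
  let e : N ≃* ι.range := MonoidHom.ofInjective hι
  refine ⟨(MulAut.congr e.symm).toMonoidHom.comp (MulAut.conjNormal (H := ι.range)), ?_⟩
  intro g a
  have h (x : ι.range) : ι (e.symm x) = x := congrArg Subtype.val (e.apply_symm_apply x)
  exact (h _).trans (MulAut.conjNormal_apply g (e a))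

namespace IsExtensionDatum

variable {N H E : Type*} [Group N] [Group H] [Group E] {k : ℕ} {s : Fin k → H}
  {ι : N →* E} {π : E →* H} {t : Fin k → E}

theorem closure_eq_top (h : IsExtensionDatum s ι π t)
    (hs : Subgroup.closure (Set.range s) = ⊤) :
    Subgroup.closure (Set.range ι ∪ Set.range t) = ⊤ := by
  obtain ⟨-, -, -, hker, ht⟩ := h
  set K := Subgroup.closure (Set.range ι ∪ Set.range t)
  have hK : π.ker ≤ K := by
    rw [hker]
    rintro _ ⟨a, rfl⟩
    exact Subgroup.subset_closure (Or.inl ⟨a, rfl⟩)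
  have hmap : K.map π = ⊤ := by
    rw [eq_top_iff, ← hs, Subgroup.closure_le]
    rintro _ ⟨i, rfl⟩
    exact ⟨t i, Subgroup.subset_closure (Or.inr ⟨i, rfl⟩), ht i⟩
  rw [← Subgroup.comap_map_eq_self hK, hmap, Subgroup.comap_top]

theorem injective_prod (h : IsExtensionDatum s ι π t) (hZ : Subgroup.center N = ⊥)
    {φ : E →* MulAut N} (hφ : ∀ g a, ι (φ g a) = g * ι a * g⁻¹) :
    Function.Injective (φ.prod π) := by
  obtain ⟨hι, -, -, hker, -⟩ := h
  rw [injective_iff_map_eq_one]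
  intro g hg
  obtain ⟨hg₁, hg₂⟩ := Prod.ext_iff.mp hg
  obtain ⟨n, rfl⟩ : g ∈ ι.range := hker ▸ hg₂
  have hn : n ∈ Subgroup.center N := by
    refine Subgroup.mem_center_iff.mpr fun a => hι ?_
    have hφa : φ (ι n) = 1 := hg₁
    have ha := hφ (ι n) a
    rw [hφa, MulAut.one_apply, eq_mul_inv_iff_mul_eq] at ha
    simpa using ha
  rw [hZ, Subgroup.mem_bot] at hn
  rw [hn, map_one]

theorem prod_apply_left (h : IsExtensionDatum s ι π t)
    {φ : E →* MulAut N} (hφ : ∀ g a, ι (φ g a) = g * ι a * g⁻¹) (a : N) :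
    φ.prod π (ι a) = (MulAut.conj a, 1) := by
  obtain ⟨hι, -, -, hker, -⟩ := h
  refine Prod.ext (MulEquiv.ext fun b => hι ?_) ?_
  · simp [hφ]
  · change ι a ∈ π.ker
    exact hker ▸ ⟨a, rfl⟩

theorem range_prod (h : IsExtensionDatum s ι π t)
    (hs : Subgroup.closure (Set.range s) = ⊤)
    {φ : E →* MulAut N} (hφ : ∀ g a, ι (φ g a) = g * ι a * g⁻¹) :
    (φ.prod π).range = Subgroup.closure
      (Set.range (fun a : N => ((MulAut.conj a, 1) : MulAut N × H)) ∪
        Set.range fun i => φ.prod π (t i)) := by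
  rw [MonoidHom.range_eq_map, ← h.closure_eq_top hs, MonoidHom.map_closure, Set.image_union,
    ← Set.range_comp, ← Set.range_comp]
  simp only [Function.comp_def, h.prod_apply_left hφ]

end IsExtensionDatum

/-- If `N` has trivial center, then any two extension data
of `N` by `H` inducing the same action are isomorphic over `N` respecting the
lifts. -/
theorem extensions_isomorphic_of_trivial_center
    {N H E₁ E₂ : Type*} [Group N] [Group H] [Group E₁] [Group E₂]
    (hZ : Subgroup.center N = ⊥)
    {k : ℕ} (s : Fin k → H) (hs : Subgroup.closure (Set.range s) = ⊤)
    (ι₁ : N →* E₁) (π₁ : E₁ →* H) (t₁ : Fin k → E₁)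
    (ι₂ : N →* E₂) (π₂ : E₂ →* H) (t₂ : Fin k → E₂)
    (h₁ : IsExtensionDatum s ι₁ π₁ t₁) (h₂ : IsExtensionDatum s ι₂ π₂ t₂)
    (hact : SameAction ι₁ t₁ ι₂ t₂) :
    ∃ f : E₁ ≃* E₂, (∀ a : N, f (ι₁ a) = ι₂ a) ∧ ∀ i, f (t₁ i) = t₂ i := by
  obtain ⟨φ₁, hφ₁⟩ := exists_conj_action ι₁ h₁.1 h₁.2.1
  obtain ⟨φ₂, hφ₂⟩ := exists_conj_action ι₂ h₂.1 h₂.2.1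
  have ht (i : Fin k) : φ₁.prod π₁ (t₁ i) = φ₂.prod π₂ (t₂ i) := by
    refine Prod.ext (MulEquiv.ext fun a => ?_)
      ((h₁.2.2.2.2 i).trans (h₂.2.2.2.2 i).symm)
    obtain ⟨b, hb₁, hb₂⟩ := hact a i
    exact (h₁.1 ((hφ₁ _ a).trans hb₁)).trans (h₂.1 ((hφ₂ _ a).trans hb₂)).symm
  have hrange : (φ₁.prod π₁).range = (φ₂.prod π₂).range := by
    rw [h₁.range_prod hs hφ₁, h₂.range_prod hs hφ₂]
    simp only [ht]
  have hinj₂ := h₂.injective_prod hZ hφ₂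
  let e₂ := MonoidHom.ofInjective hinj₂
  let f : E₁ ≃* E₂ := (MonoidHom.ofInjective (h₁.injective_prod hZ hφ₁)).trans
    ((MulEquiv.subgroupCongr hrange).trans e₂.symm)
  have hf (x : E₁) : φ₂.prod π₂ (f x) = φ₁.prod π₁ x :=
    congrArg Subtype.val (e₂.apply_symm_apply _)
  refine ⟨f, fun a => hinj₂ ?_, fun i => hinj₂ ((hf _).trans (ht i))⟩
  rw [hf, h₁.prod_apply_left hφ₁, h₂.prod_apply_left hφ₂]
end
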